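/- Let f₁,…,f_N : ℝ^D → ℝ be differentiable functions, each strongly concave with constant L₀ > 0, i.e., f_n(θ) ≤ f_n(θ₀) + ⟨∇f_n(θ₀), θ−θ₀⟩ − L₀‖θ−θ₀‖² for all θ, θ₀. Let θ₀ ∈ ℝ^D, let M ≤ N, and let v ∈ ℝ^M with v ≥ 0 and Σ_{m=1}^M v_m = 1 satisfy the gradient-matching condition Σ_{m=1}^M v_m ∇f_m(θ₀) = (1/N) Σ_{n=1}^N ∇f_n(θ₀). Then for every t ∈ [0,1] and every θ ∈ ℝ^D: t·Σ_{n=1}^N (f_n(θ) − f_n(θ₀)) + N(1−t)·Σ_{m=1}^M v_m (f_m(θ) − f_m(θ₀)) ≤ ⟨Σ_{n=1}^N ∇f_n(θ₀), θ−θ₀⟩ − N·L₀·‖θ−θ₀‖². -/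

import Mathlib

open RealInnerProductSpace

/-- Let `f₁, …, f_N : ℝ^D → ℝ` be differentiable and strongly concave with
constant `L₀ > 0` (in the sense `f_n θ ≤ f_n θ₀ + ⟨∇f_n θ₀, θ−θ₀⟩ − L₀‖θ−θ₀‖²`).  If
`v ∈ ℝ^M` (`M ≤ N`) is nonnegative, sums to one, and matches the average gradient at `θ₀`,
then for all `t ∈ [0,1]` and all `θ`:
`t ∑ₙ (fₙ θ − fₙ θ₀) + N(1−t) ∑ₘ vₘ (fₘ θ − fₘ θ₀)
  ≤ ⟨∑ₙ ∇fₙ θ₀, θ−θ₀⟩ − N L₀ ‖θ−θ₀‖²`. -/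
theorem tilted_exponent_bound {D N M : ℕ} (hMN : M ≤ N)
    (f : Fin N → EuclideanSpace ℝ (Fin D) → ℝ) (L₀ : ℝ) (hL₀ : 0 < L₀)
    (hdiff : ∀ n, Differentiable ℝ (f n))
    (hconc : ∀ n, ∀ θ θ₀ : EuclideanSpace ℝ (Fin D),
      f n θ ≤ f n θ₀ + ⟪gradient (f n) θ₀, θ - θ₀⟫ - L₀ * ‖θ - θ₀‖ ^ 2)
    (θ₀ : EuclideanSpace ℝ (Fin D)) (v : Fin M → ℝ) (hv0 : ∀ m, 0 ≤ v m)
    (hv1 : ∑ m, v m = 1)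
    (hgrad : ∑ m, v m • gradient (f (Fin.castLE hMN m)) θ₀ =
      (N : ℝ)⁻¹ • ∑ n, gradient (f n) θ₀) :
    ∀ t : ℝ, 0 ≤ t → t ≤ 1 → ∀ θ : EuclideanSpace ℝ (Fin D),
      t * (∑ n, (f n θ - f n θ₀)) +
          (N : ℝ) * (1 - t) * (∑ m, v m * (f (Fin.castLE hMN m) θ - f (Fin.castLE hMN m) θ₀)) ≤
        ⟪∑ n, gradient (f n) θ₀, θ - θ₀⟫ - (N : ℝ) * L₀ * ‖θ - θ₀‖ ^ 2 := by
  intro t ht0 ht1 θ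
  have hN : (N : ℝ) ≠ 0 := by
    rintro h
    obtain rfl : N = 0 := by exact_mod_cast h
    obtain rfl : M = 0 := Nat.le_zero.mp hMN
    simp at hv1
  have hfull : ∑ n, (f n θ - f n θ₀) ≤
      ⟪∑ n, gradient (f n) θ₀, θ - θ₀⟫ - (N : ℝ) * L₀ * ‖θ - θ₀‖ ^ 2 := by
    calc ∑ n, (f n θ - f n θ₀)
        ≤ ∑ n, (⟪gradient (f n) θ₀, θ - θ₀⟫ - L₀ * ‖θ - θ₀‖ ^ 2) :=
          Finset.sum_le_sum fun n _ => by linarith [hconc n θ θ₀]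
      _ = _ := by
          rw [Finset.sum_sub_distrib, sum_inner]
          simp [mul_assoc]
  have hcoreset : ∑ m, v m * (f (Fin.castLE hMN m) θ - f (Fin.castLE hMN m) θ₀) ≤
      (N : ℝ)⁻¹ * ⟪∑ n, gradient (f n) θ₀, θ - θ₀⟫ - L₀ * ‖θ - θ₀‖ ^ 2 := by
    calc ∑ m, v m * (f (Fin.castLE hMN m) θ - f (Fin.castLE hMN m) θ₀)
        ≤ ∑ m, v m *
            (⟪gradient (f (Fin.castLE hMN m)) θ₀, θ - θ₀⟫ - L₀ * ‖θ - θ₀‖ ^ 2) :=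
          Finset.sum_le_sum fun m _ => mul_le_mul_of_nonneg_left
            (by linarith [hconc (Fin.castLE hMN m) θ θ₀]) (hv0 m)
      _ = _ := by
          rw [← real_inner_smul_left, ← hgrad, sum_inner]
          simp only [mul_sub, Finset.sum_sub_distrib, ← Finset.sum_mul, hv1, one_mul,
            real_inner_smul_left]
  have hscaled := mul_le_mul_of_nonneg_left hcoreset
    (mul_nonneg (Nat.cast_nonneg N) (sub_nonneg.mpr ht1) : 0 ≤ (N : ℝ) * (1 - t))
  refine (add_le_add (mul_le_mul_of_nonneg_left hfull ht0) hscaled).trans_eq ?_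
  field_simp
  ring
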